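/- f(Hol(Z_5)) = 5, where Hol(Z_5) = <x, y | x^5 = y^4 = 1, x^2 y = y x>; that is, every sequence of length d(Hol(Z_5)) = 8 over Hol(Z_5) contains a nonempty product-one subsequence of length at most 5, and 5 is optimal. -/

import Mathlib

open List Subgroup

/-- The set of all products of the terms of `S` in all orders. -/
def PiSet {G : Type*} [Group G] (S : List G) : Set G :=
  {g | ∃ l : List G, l.Perm S ∧ l.prod = g}

/-- `S` is a product-one sequence if `1 ∈ Π(S)`. -/
def IsProdOne {G : Type*} [Group G] (S : List G) : Prop :=
  (1 : G) ∈ PiSet S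

/-- The Davenport constant `d(G)`: the smallest `m` such that every sequence of
length `m` over `G` contains a nonempty product-one subsequence. -/
noncomputable def dC (G : Type*) [Group G] : ℕ :=
  sInf {m | 0 < m ∧ ∀ S : List G, S.length = m →
    ∃ T : List G, T ≠ [] ∧ T.Sublist S ∧ IsProdOne T}

/-- `e(G)`: the smallest `m` such that every nonempty product-one sequence over `G`
contains a nonempty product-one subsequence of length at most `m`. -/
noncomputable def eC (G : Type*) [Group G] : ℕ :=
  sInf {m | 0 < m ∧ ∀ S : List G, S ≠ [] → IsProdOne S →
    ∃ T : List G, T ≠ [] ∧ T.Sublist S ∧ T.length ≤ m ∧ IsProdOne T}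

/-- `f(G)`: the smallest `m` such that every sequence of length `d(G)` over `G`
contains a nonempty product-one subsequence of length at most `m`. -/
noncomputable def fC (G : Type*) [Group G] : ℕ :=
  sInf {m | 0 < m ∧ ∀ S : List G, S.length = dC G →
    ∃ T : List G, T ≠ [] ∧ T.Sublist S ∧ T.length ≤ m ∧ IsProdOne T}

/-- The `k`-th Davenport constant `d_k(G)`: the smallest `m` such that every sequence of
length `m` over `G` contains `k` pairwise disjoint nonempty product-one subsequences. -/
noncomputable def dkC (G : Type*) [Group G] (k : ℕ) : ℕ :=
  sInf {m | 0 < m ∧ ∀ S : List G, S.length = m →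
    ∃ Ts : List (List G), Ts.length = k ∧ (∀ T ∈ Ts, T ≠ [] ∧ IsProdOne T) ∧
      (Ts.flatten : Multiset G) ≤ (S : Multiset G)}

/-! ### Coding the group by natural numbers

The element `x ^ a * y ^ k` with `a < 5` and `k < 4` is coded by `5 * k + a`. -/

/-- The group element with code `c`. -/
def decode {G : Type*} [Group G] (x y : G) (c : ℕ) : G := x ^ (c % 5) * y ^ (c / 5)

/-- The code of a product. -/
def codeMul (c d : ℕ) : ℕ :=
  5 * ((c / 5 + d / 5) % 4) + (c % 5 + 2 ^ (c / 5) * (d % 5)) % 5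

/-- The code of an inverse. -/
def codeInv (c : ℕ) : ℕ :=
  5 * ((4 - c / 5) % 4) + (2 ^ (4 - c / 5) * (5 - c % 5)) % 5

section Coding

variable {G : Type*} [Group G] {x y : G}

lemma pow_mul_pow_of_rel (hrel : x ^ 2 * y = y * x) (k b : ℕ) :
    y ^ k * x ^ b = x ^ (2 ^ k * b) * y ^ k := by
  have h : ∀ b : ℕ, y * x ^ b = x ^ (2 * b) * y := by
    intro b
    induction b with
    | zero => simp
    | succ b ih =>
      rw [pow_succ, ← mul_assoc, ih, mul_assoc, ← hrel, ← mul_assoc, ← pow_add]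
      rfl
  induction k generalizing b with
  | zero => simp
  | succ k ih =>
    rw [pow_succ, mul_assoc, h, ← mul_assoc, ih, mul_assoc, ← pow_succ, pow_succ 2 k, mul_assoc]

lemma decode_codeMul (hordx : orderOf x = 5) (hordy : orderOf y = 4)
    (hrel : x ^ 2 * y = y * x) (c d : ℕ) :
    decode x y (codeMul c d) = decode x y c * decode x y d := by
  have h1 : codeMul c d % 5 = (c % 5 + 2 ^ (c / 5) * (d % 5)) % 5 := by
    unfold codeMul; omega
  have h2 : codeMul c d / 5 = (c / 5 + d / 5) % 4 := by
    unfold codeMul; omega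
  have hx : ∀ n, x ^ (n % 5) = x ^ n := fun n => by rw [← hordx, pow_mod_orderOf]
  have hy : ∀ n, y ^ (n % 4) = y ^ n := fun n => by rw [← hordy, pow_mod_orderOf]
  unfold decode
  rw [h1, h2, hx, hy, pow_add, pow_add, mul_assoc (x ^ (c % 5)) (y ^ (c / 5)),
    ← mul_assoc (y ^ (c / 5)), pow_mul_pow_of_rel hrel]
  simp only [mul_assoc]

lemma decode_zero : decode x y 0 = 1 := by simp [decode]

lemma decode_codeInv (hordx : orderOf x = 5) (hordy : orderOf y = 4)
    (hrel : x ^ 2 * y = y * x) {c : ℕ} (hc : c < 20) :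
    decode x y c * decode x y (codeInv c) = 1 := by
  rw [← decode_codeMul hordx hordy hrel]
  have h : ∀ c < 20, codeMul c (codeInv c) = 0 := by decide
  rw [h c hc, decode_zero]

lemma codeMul_lt (c d : ℕ) : codeMul c d < 20 := by
  unfold codeMul; omega

lemma codeInv_lt (c : ℕ) : codeInv c < 20 := by
  unfold codeInv; omega

lemma exists_decode_eq (hordx : orderOf x = 5) (hordy : orderOf y = 4)
    (hrel : x ^ 2 * y = y * x) (hgen : Subgroup.closure ({x, y} : Set G) = ⊤) (g : G) :
    ∃ c < 20, decode x y c = g := by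
  have hg : g ∈ Subgroup.closure ({x, y} : Set G) := hgen ▸ Subgroup.mem_top g
  induction hg using Subgroup.closure_induction with
  | mem g hg =>
    rcases hg with rfl | rfl
    · exact ⟨1, by norm_num, by simp [decode]⟩
    · exact ⟨5, by norm_num, by simp [decode]⟩
  | one => exact ⟨0, by norm_num, decode_zero⟩
  | mul g h _ _ hg hh =>
    obtain ⟨c, -, rfl⟩ := hg
    obtain ⟨d, -, rfl⟩ := hh
    exact ⟨_, codeMul_lt c d, decode_codeMul hordx hordy hrel c d⟩
  | inv g _ hg =>
    obtain ⟨c, hc, rfl⟩ := hg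
    exact ⟨_, codeInv_lt c, (inv_eq_of_mul_eq_one_right
      (decode_codeInv hordx hordy hrel hc)).symm⟩

end Coding

/-! ### Exhaustive search

A set of pairs `(c, l)` with `l < 5` is stored as the natural number `w` whose bit `5 * c + l`
records membership: it says that the product of some `l` terms of the current sequence, in
some order, has code `c`. -/

/-- The lengths recorded in `w` for the code `c`, restricted by the bit mask `m`. -/
def lengthBits (w m c : ℕ) : ℕ := Nat.land (Nat.shiftRight w (Nat.mul 5 c)) m

/-- `f n`, with `n` evaluated first when computing in the kernel. -/
def applyEvaluated {α : Type} (n : ℕ) (f : ℕ → α) : α :=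
  Nat.rec (f 0) (fun k _ => f (Nat.succ k)) n

/-- The pairs obtained from `w` by multiplying, on either side, by the element whose inverse
has code `i`. -/
def extendBits (w i : ℕ) : ℕ :=
  Nat.rec 0 (fun c r => Nat.lor r (Nat.shiftLeft
    (Nat.lor (lengthBits w 15 (codeMul i c)) (lengthBits w 15 (codeMul c i)))
    (Nat.succ (Nat.mul 5 c)))) 20

/-- Whether a nonempty word of length at most `n` in distinct terms of `S` has a product
inverse to the element with code `p`. -/
def hasWord : ℕ → ℕ → List ℕ → Bool
  | 0, _, _ => false
  | n + 1, p, S => S.any fun c =>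
    applyEvaluated (codeMul p c) fun q => Nat.beq q 0 || hasWord n q (S.erase c)

/-- One level of `search`: tries to add to `S` each of the candidates in turn. -/
def searchStep (next : List ℕ → ℕ → List ℕ → Bool) : List ℕ → ℕ → List ℕ → Bool
  | [], _, _ => true
  | c :: cs, w, S =>
    (Nat.ble 1 (lengthBits w 31 (codeInv c)) ||
      applyEvaluated (Nat.lor w (extendBits w (codeInv c))) fun w' => next (c :: cs) w' (c :: S)) &&
    searchStep next cs w S

/-- Checks that each extension of `S` by `n` candidates has a short product-one subsequence. -/
def search : ℕ → List ℕ → ℕ → List ℕ → Bool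
  | 0 => fun _ _ S => hasWord 5 0 S
  | n + 1 => searchStep (search n)

lemma applyEvaluated_eq {α : Type} (n : ℕ) (f : ℕ → α) : applyEvaluated n f = f n := by
  cases n <;> rfl

lemma exists_testBit_of_lengthBits_ne_zero {w c : ℕ} (h : lengthBits w 31 c ≠ 0) :
    ∃ l < 5, w.testBit (5 * c + l) := by
  obtain ⟨l, hl⟩ := Nat.exists_testBit_of_ne_zero h
  change ((w >>> (5 * c)) &&& (2 ^ 5 - 1)).testBit l = true at hl
  rw [Nat.testBit_and, Nat.testBit_shiftRight, Nat.testBit_two_pow_sub_one] at hl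
  simp only [Bool.and_eq_true, decide_eq_true_eq] at hl
  exact ⟨l, hl.2, hl.1⟩

lemma testBit_lengthBits {w c l : ℕ} (h : (lengthBits w 15 c).testBit l) :
    l < 4 ∧ w.testBit (5 * c + l) := by
  change ((w >>> (5 * c)) &&& (2 ^ 4 - 1)).testBit l = true at h
  rw [Nat.testBit_and, Nat.testBit_shiftRight, Nat.testBit_two_pow_sub_one] at h
  simp only [Bool.and_eq_true, decide_eq_true_eq] at h
  exact ⟨h.2, h.1⟩

lemma testBit_extendBits {w i j : ℕ} (h : (extendBits w i).testBit j) :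
    ∃ c l, j = 5 * c + (l + 1) ∧ l < 4 ∧
      (w.testBit (5 * codeMul i c + l) ∨ w.testBit (5 * codeMul c i + l)) := by
  unfold extendBits at h
  generalize 20 = n at h
  induction n with
  | zero => simp at h
  | succ c ih =>
    change (_ ||| ((lengthBits w 15 (codeMul i c) ||| lengthBits w 15 (codeMul c i)) <<<
      (5 * c + 1))).testBit j = true at h
    rw [Nat.testBit_or, Nat.testBit_shiftLeft, Nat.testBit_or] at h
    simp only [Bool.or_eq_true, Bool.and_eq_true, decide_eq_true_eq] at h
    rcases h with h | ⟨hj, h | h⟩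
    · exact ih h
    · obtain ⟨h4, h⟩ := testBit_lengthBits h
      exact ⟨c, _, by omega, h4, Or.inl h⟩
    · obtain ⟨h4, h⟩ := testBit_lengthBits h
      exact ⟨c, _, by omega, h4, Or.inr h⟩

section Soundness

variable {G : Type*} [Group G] {x y : G}

/-- `S` contains a nonempty product-one subsequence of length at most `n`. -/
def HasShortProdOne (n : ℕ) (S : List G) : Prop :=
  ∃ T : List G, T ≠ [] ∧ T <+~ S ∧ T.length ≤ n ∧ T.prod = 1

lemma HasShortProdOne.mono {n : ℕ} {S S' : List G} (h : HasShortProdOne n S) (hS : S <+~ S') :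
    HasShortProdOne n S' :=
  let ⟨T, h0, hT, hn, h1⟩ := h
  ⟨T, h0, hT.trans hS, hn, h1⟩

lemma HasShortProdOne.exists_sublist {n : ℕ} {S : List G} (h : HasShortProdOne n S) :
    ∃ T : List G, T ≠ [] ∧ T.Sublist S ∧ T.length ≤ n ∧ IsProdOne T := by
  obtain ⟨T, h0, ⟨T', hperm, hsub⟩, hn, h1⟩ := h
  refine ⟨T', ?_, hsub, hperm.length_eq ▸ hn, T, hperm.symm, h1⟩
  rintro rfl
  exact h0 hperm.symm.eq_nil

lemma exists_word_of_hasWord (hordx : orderOf x = 5) (hordy : orderOf y = 4)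
    (hrel : x ^ 2 * y = y * x) {n p : ℕ} {S : List ℕ} (h : hasWord n p S = true) :
    ∃ T : List ℕ, T ≠ [] ∧ T <+~ S ∧ T.length ≤ n ∧
      decode x y p * (T.map (decode x y)).prod = 1 := by
  induction n generalizing p S with
  | zero => simp [hasWord] at h
  | succ n ih =>
    simp only [hasWord, applyEvaluated_eq, List.any_eq_true, Bool.or_eq_true,
      Nat.beq_eq] at h
    obtain ⟨c, hc, h | h⟩ := h
    · refine ⟨[c], by simp, List.singleton_subperm_iff.2 hc, by simp, ?_⟩
      rw [List.map_singleton, List.prod_singleton, ← decode_codeMul hordx hordy hrel, h,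
        decode_zero]
    · obtain ⟨T, -, hT, hlen, h1⟩ := ih h
      refine ⟨c :: T, by simp, ((List.subperm_cons c).2 hT).trans
        (List.perm_cons_erase hc).symm.subperm, by simpa using hlen, ?_⟩
      rw [List.map_cons, List.prod_cons, ← mul_assoc, ← decode_codeMul hordx hordy hrel, h1]

/-- The set of pairs stored in `w` is correct for the sequence coded by `S`. -/
def RecordsWords (x y : G) (w : ℕ) (S : List ℕ) : Prop :=
  ∀ c l, l < 5 → w.testBit (5 * c + l) →
    ∃ T : List G, T <+~ S.map (decode x y) ∧ T.length = l ∧ T.prod = decode x y c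

lemma RecordsWords.cons (hordx : orderOf x = 5) (hordy : orderOf y = 4)
    (hrel : x ^ 2 * y = y * x) {w c : ℕ} {S : List ℕ} (hw : RecordsWords x y w S) (hc : c < 20) :
    RecordsWords x y (w ||| extendBits w (codeInv c)) (c :: S) := by
  intro d l hl h
  have hinv : (decode x y c)⁻¹ = decode x y (codeInv c) :=
    inv_eq_of_mul_eq_one_right (decode_codeInv hordx hordy hrel hc)
  rw [Nat.testBit_or, Bool.or_eq_true] at h
  rw [List.map_cons]
  rcases h with h | h
  · obtain ⟨T, hT, hlen, hprod⟩ := hw d l hl h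
    exact ⟨T, hT.trans (List.sublist_cons_self _ _).subperm, hlen, hprod⟩
  replace h := testBit_extendBits h
  obtain ⟨d', l', hj, hl', h⟩ := h
  obtain rfl : d = d' := by omega
  obtain rfl : l = l' + 1 := by omega
  rcases h with h | h
  · obtain ⟨T, hT, hlen, hprod⟩ := hw _ l' (by omega) h
    refine ⟨decode x y c :: T, (List.subperm_cons _).2 hT, by simp [hlen], ?_⟩
    rw [List.prod_cons, hprod, decode_codeMul hordx hordy hrel, ← hinv, mul_inv_cancel_left]
  · obtain ⟨T, hT, hlen, hprod⟩ := hw _ l' (by omega) h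
    refine ⟨T ++ [decode x y c], (List.perm_append_singleton _ _).subperm.trans
      ((List.subperm_cons _).2 hT), by simp [hlen], ?_⟩
    rw [List.prod_append, List.prod_singleton, hprod, decode_codeMul hordx hordy hrel, ← hinv,
      inv_mul_cancel_right]

lemma hasShortProdOne_of_search (hordx : orderOf x = 5) (hordy : orderOf y = 4)
    (hrel : x ^ 2 * y = y * x) {n w : ℕ} {cs S : List ℕ} (h : search n cs w S = true)
    (hcs : ∀ c ∈ cs, c < 20) (hw : RecordsWords x y w S) {L : List ℕ} (hL : L.length = n)
    (hLcs : ∀ c ∈ L, c ∈ cs) : HasShortProdOne 5 ((L ++ S).map (decode x y)) := by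
  induction n generalizing cs w S L with
  | zero =>
    obtain rfl := List.length_eq_zero_iff.1 hL
    obtain ⟨T, h0, hT, hlen, h1⟩ := exists_word_of_hasWord hordx hordy hrel h
    obtain ⟨T', hperm, hsub⟩ := hT
    exact ⟨T.map (decode x y), by simpa using h0, ⟨_, hperm.map _, hsub.map _⟩, by simpa using hlen,
      by simpa [decode_zero] using h1⟩
  | succ n ihn =>
    change searchStep (search n) cs w S = true at h
    induction cs with
    | nil =>
      obtain ⟨c, L, rfl⟩ := List.exists_cons_of_length_eq_add_one hL
      exact absurd (hLcs c (by simp)) (by simp)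
    | cons c cs ihcs =>
      simp only [searchStep, applyEvaluated_eq, Bool.and_eq_true, Bool.or_eq_true] at h
      have hc : c < 20 := hcs c (by simp)
      by_cases hcL : c ∈ L
      · have hperm : L ++ S ~ L.erase c ++ c :: S :=
          ((List.perm_cons_erase hcL).append_right S).trans List.perm_middle.symm
        refine HasShortProdOne.mono ?_ (hperm.symm.map _).subperm
        rcases h.1 with h | h
        · obtain ⟨l, hl, hbit⟩ := exists_testBit_of_lengthBits_ne_zero
            (Nat.one_le_iff_ne_zero.1 (Nat.le_of_ble_eq_true h))
          obtain ⟨T, hT, hlen, hprod⟩ := hw _ l hl hbit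
          refine HasShortProdOne.mono (S := (c :: S).map (decode x y)) ?_
            ((List.sublist_append_right _ _).map _).subperm
          refine ⟨decode x y c :: T, by simp, (List.subperm_cons _).2 hT,
            by simp only [List.length_cons]; omega, ?_⟩
          rw [List.prod_cons, hprod, decode_codeInv hordx hordy hrel hc]
        · refine ihn h hcs (hw.cons hordx hordy hrel hc) ?_ fun d hd => hLcs d
            (List.mem_of_mem_erase hd)
          rw [List.length_erase_of_mem hcL, hL, Nat.add_sub_cancel]
      · refine ihcs (fun d hd => hcs d (by simp [hd])) (fun d hd => ?_) h.2
        rcases List.mem_cons.1 (hLcs d hd) with rfl | h'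
        · exact absurd hd hcL
        · exact h'

set_option maxRecDepth 100000 in
lemma search_eight : search 8 (List.range 20) 1 [] = true := by decide +kernel

lemma hasShortProdOne_of_length_eq_eight (hordx : orderOf x = 5) (hordy : orderOf y = 4)
    (hrel : x ^ 2 * y = y * x) (hgen : Subgroup.closure ({x, y} : Set G) = ⊤)
    {S : List G} (hS : S.length = 8) : HasShortProdOne 5 S := by
  choose f hf20 hf using exists_decode_eq hordx hordy hrel hgen
  have hw : RecordsWords x y 1 [] := by
    intro c l _ h
    obtain ⟨rfl, rfl⟩ : c = 0 ∧ l = 0 := by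
      have := Nat.testBit_one_eq_true_iff_self_eq_zero.1 h
      omega
    exact ⟨[], by simp, rfl, by simp [decode_zero]⟩
  have := hasShortProdOne_of_search hordx hordy hrel search_eight (by simp) hw
    (L := S.map f) (by simpa using hS) (by simp [hf20])
  simpa [Function.comp_def, hf] using this

end Soundness

/-! ### Sequences without short product-one subsequences -/

section Free

variable {G : Type*} [Group G] {x y : G}

lemma exists_prod_eq_pow_mul_pow_count [DecidableEq G] (hrel : x ^ 2 * y = y * x) (hxy : x ≠ y)
    {l : List G} (hl : ∀ g ∈ l, g = x ∨ g = y) : ∃ a, l.prod = x ^ a * y ^ l.count y := by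
  induction l with
  | nil => exact ⟨0, by simp⟩
  | cons g l ih =>
    obtain ⟨a, ha⟩ := ih fun h hh => hl h (by simp [hh])
    rcases hl g (by simp) with rfl | rfl
    · refine ⟨a + 1, ?_⟩
      rw [List.prod_cons, ha, List.count_cons_of_ne hxy, pow_succ', mul_assoc]
    · refine ⟨2 * a, ?_⟩
      have := pow_mul_pow_of_rel hrel 1 a
      rw [pow_one, pow_one] at this
      rw [List.prod_cons, ha, List.count_cons_self, ← mul_assoc, this, pow_succ', mul_assoc]

lemma eq_nil_of_isProdOne_of_sublist (hordx : orderOf x = 5) (hordy : orderOf y = 4)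
    (hrel : x ^ 2 * y = y * x) {T : List G}
    (hT : T.Sublist (List.replicate 4 x ++ List.replicate 3 y)) (h : IsProdOne T) : T = [] := by
  classical
  have hxy : x ≠ y := by
    rintro rfl
    omega
  obtain ⟨l, hl, hprod⟩ := h
  obtain ⟨T₁, T₂, rfl, h₁, h₂⟩ := List.sublist_append_iff.1 hT
  obtain ⟨i, hi, rfl⟩ := List.sublist_replicate_iff.1 h₁
  obtain ⟨j, hj, rfl⟩ := List.sublist_replicate_iff.1 h₂
  have hcount : l.count y = j := by
    rw [hl.count_eq, List.count_append, List.count_replicate_self, List.count_replicate]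
    simp [hxy]
  obtain ⟨a, ha⟩ := exists_prod_eq_pow_mul_pow_count hrel hxy (l := l) fun g hg => by
    have := hl.mem_iff.1 hg
    simp only [List.mem_append, List.mem_replicate] at this
    tauto
  rw [hprod, hcount] at ha
  have hy : y ^ (j * 5) = 1 := by
    rw [pow_mul, ← inv_eq_of_mul_eq_one_right ha.symm, inv_pow, ← pow_mul, mul_comm, pow_mul,
      ← hordx, pow_orderOf_eq_one, one_pow, inv_one]
  have hdvd := orderOf_dvd_of_pow_eq_one hy
  rw [hordy] at hdvd
  obtain rfl : j = 0 := by omega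
  rw [List.replicate_zero, List.append_nil] at hl ⊢
  rw [List.perm_replicate.1 hl, List.prod_replicate] at hprod
  have hdvd' := orderOf_dvd_of_pow_eq_one hprod
  rw [hordx] at hdvd'
  obtain rfl : i = 0 := by omega
  rfl

lemma orderOf_le_length_of_isProdOne {n : ℕ} {T : List G}
    (hT : T.Sublist (List.replicate n x)) (h0 : T ≠ []) (h : IsProdOne T) :
    orderOf x ≤ T.length := by
  obtain ⟨l, hl, hprod⟩ := h
  obtain ⟨i, -, rfl⟩ := List.sublist_replicate_iff.1 hT
  rw [List.perm_replicate.1 hl, List.prod_replicate] at hprod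
  rw [List.length_replicate]
  refine Nat.le_of_dvd (Nat.pos_of_ne_zero ?_) (orderOf_dvd_of_pow_eq_one hprod)
  rintro rfl
  exact h0 rfl

end Free


/-- `f(Hol(Z_5)) = 5`, where `Hol(Z_5) = ⟨x, y | x^5 = y^4 = 1, x^2 y = y x⟩`
and `d(Hol(Z_5)) = 8`. -/
theorem hol_z5_f (G : Type*) [Group G] [Finite G] (x y : G)
    (hordx : orderOf x = 5) (hordy : orderOf y = 4)
    (hrel : x ^ 2 * y = y * x)
    (hgen : Subgroup.closure ({x, y} : Set G) = ⊤) :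
    dC G = 8 ∧ fC G = 5 := by
  have hmain : ∀ S : List G, S.length = 8 →
      ∃ T : List G, T ≠ [] ∧ T.Sublist S ∧ T.length ≤ 5 ∧ IsProdOne T := fun S hS =>
    (hasShortProdOne_of_length_eq_eight hordx hordy hrel hgen hS).exists_sublist
  have hd : dC G = 8 := by
    have hmem : 8 ∈ {m | 0 < m ∧ ∀ S : List G, S.length = m →
        ∃ T : List G, T ≠ [] ∧ T.Sublist S ∧ IsProdOne T} :=
      ⟨by norm_num, fun S hS => let ⟨T, h0, hT, _, h1⟩ := hmain S hS; ⟨T, h0, hT, h1⟩⟩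
    refine le_antisymm (Nat.sInf_le hmem) (le_csInf ⟨8, hmem⟩ fun m hm => ?_)
    by_contra! hlt
    obtain ⟨T, h0, hT, h1⟩ :=
      hm.2 ((List.replicate 4 x ++ List.replicate 3 y).take m) (by simp; omega)
    exact h0 (eq_nil_of_isProdOne_of_sublist hordx hordy hrel
      (hT.trans (List.take_sublist _ _)) h1)
  refine ⟨hd, ?_⟩
  have hmem : 5 ∈ {m | 0 < m ∧ ∀ S : List G, S.length = dC G →
      ∃ T : List G, T ≠ [] ∧ T.Sublist S ∧ T.length ≤ m ∧ IsProdOne T} :=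
    ⟨by norm_num, fun S hS => hmain S (hS.trans hd)⟩
  refine le_antisymm (Nat.sInf_le hmem) (le_csInf ⟨5, hmem⟩ fun m hm => ?_)
  obtain ⟨T, h0, hT, hlen, h1⟩ := hm.2 (List.replicate (dC G) x) (by simp)
  rw [← hordx]
  exact (orderOf_le_length_of_isProdOne hT h0 h1).trans hlen
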